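/- Assume Z_M ≠ 0, Z_T ≠ 0, Z_L + Z_M ≠ 0, Z_S + Z_M ≠ 0, and 1/(Z_L+Z_M) + 2/(Z_S+Z_M) ≠ 0, and let Z be defined by 3/(Z+Z_M) = 1/(Z_L+Z_M) + 2/(Z_S+Z_M). Then for every unit vector r̂ ∈ ℝ³ the displacement tensor evaluated on the sphere surface satisfies U(a r̂) = I + ((Z_S − Z_T)/Z_T) · ((Z + Z_M)/(Z_S + Z_M)) · (I − r̂⊗r̂). In particular U(a r̂) = I when Z_S = Z_T (perfectly bonded interface). -/

import Mathlib

open Complex Matrix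

/-- Outer product matrix `r̂ ⊗ r̂` (complexified) of the unit radial direction of `x`. -/
noncomputable def outerUnit (x : EuclideanSpace ℝ (Fin 3)) : Matrix (Fin 3) (Fin 3) ℂ :=
  Matrix.of fun i j => (((x i / ‖x‖) * (x j / ‖x‖) : ℝ) : ℂ)

/-- The displacement tensor `U(r)` of a spherical inclusion, Eq. (471) of the paper. -/
noncomputable def Udisp (a k h : ℝ) (Z ZM ZL ZS ZT : ℂ)
    (x : EuclideanSpace ℝ (Fin 3)) : Matrix (Fin 3) (Fin 3) ℂ :=
  ((Z + ZM) * ((a : ℂ) / (‖x‖ : ℂ))) •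
    ((Complex.exp (I * k * ((‖x‖ : ℝ) - a)) / (ZL + ZM)) •
        ((1 / ((k : ℂ) * ‖x‖) ^ 2 - I / ((k : ℂ) * ‖x‖)) • (1 : Matrix (Fin 3) (Fin 3) ℂ)
          + (1 + 3 * I / ((k : ℂ) * ‖x‖) - 3 / ((k : ℂ) * ‖x‖) ^ 2) • outerUnit x)
      + (ZS / ZT * Complex.exp (I * h * ((‖x‖ : ℝ) - a)) / (ZS + ZM)) •
        ((1 + I / ((h : ℂ) * ‖x‖) - 1 / ((h : ℂ) * ‖x‖) ^ 2) • (1 : Matrix (Fin 3) (Fin 3) ℂ)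
          - (1 + 3 * I / ((h : ℂ) * ‖x‖) - 3 / ((h : ℂ) * ‖x‖) ^ 2) • outerUnit x))

lemma imp_ratio (a ρ c ω k : ℝ) (ha : 0 < a) (hρ : 0 < ρ) (hc : 0 < c) (hω : 0 < ω)
    (hk : k = ω / Real.sqrt (c / ρ)) (M L : ℂ)
    (hM : M = I * ω * (4 / 3) * Real.pi * a ^ 3 * ρ)
    (hL : L = (I * ω)⁻¹ * (4 * Real.pi * a * c) * (1 - I * k * a)) :
    k ≠ 0 ∧ L = -3 * M * (1 / ((k : ℂ) * a) ^ 2 - I / ((k : ℂ) * a)) := by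
  have hs : 0 < Real.sqrt (c / ρ) := Real.sqrt_pos.mpr (by positivity)
  have hk0 : k ≠ 0 := by rw [hk]; positivity
  have hck : c * k ^ 2 = ρ * ω ^ 2 := by
    rw [hk, div_pow, Real.sq_sqrt (by positivity)]
    field_simp
  have hckC : (c : ℂ) * (k : ℂ) ^ 2 = ρ * (ω : ℂ) ^ 2 := by exact_mod_cast hck
  have hkC : (k : ℂ) ≠ 0 := by exact_mod_cast hk0
  have haC : (a : ℂ) ≠ 0 := by exact_mod_cast ha.ne'
  have hwC : (ω : ℂ) ≠ 0 := by exact_mod_cast hω.ne'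
  refine ⟨hk0, ?_⟩
  have hcC : (c : ℂ) = ρ * (ω : ℂ) ^ 2 / (k : ℂ) ^ 2 := by
    rw [← hckC]; field_simp
  rw [hL, hM, hcC, mul_inv, Complex.inv_I]
  field_simp

/-- The displacement tensor evaluated on the sphere surface, Eq. (043) of the paper:
`U(a r̂) = I + ((Z_S−Z_T)/Z_T)((Z+Z_M)/(Z_S+Z_M))(I − r̂⊗r̂)`; in particular `U(a r̂) = I`
for a perfectly bonded interface (`Z_S = Z_T`). -/
theorem surface_displacement (a ρ lam mu ω : ℝ)
    (ha : 0 < a) (hρ : 0 < ρ) (hmu : 0 < mu) (hlam : 0 < lam + 2 * mu) (hω : 0 < ω)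
    (k h : ℝ)
    (hk : k = ω / Real.sqrt ((lam + 2 * mu) / ρ)) (hh : h = ω / Real.sqrt (mu / ρ))
    (ZM ZL ZT ZS Z : ℂ)
    (hZM : ZM = I * ω * (4 / 3) * Real.pi * a ^ 3 * ρ)
    (hZL : ZL = (I * ω)⁻¹ * (4 * Real.pi * a * (lam + 2 * mu)) * (1 - I * k * a))
    (hZT : ZT = (I * ω)⁻¹ * (4 * Real.pi * a * mu) * (1 - I * h * a))
    (hZM0 : ZM ≠ 0) (hZT0 : ZT ≠ 0) (hLM : ZL + ZM ≠ 0) (hSM : ZS + ZM ≠ 0)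
    (hsum : 1 / (ZL + ZM) + 2 / (ZS + ZM) ≠ 0)
    (hZ : 3 / (Z + ZM) = 1 / (ZL + ZM) + 2 / (ZS + ZM))
    (rhat : EuclideanSpace ℝ (Fin 3)) (hrhat : ‖rhat‖ = 1) :
    Udisp a k h Z ZM ZL ZS ZT (a • rhat)
        = 1 + ((ZS - ZT) / ZT * ((Z + ZM) / (ZS + ZM))) •
            ((1 : Matrix (Fin 3) (Fin 3) ℂ)
              - Matrix.of fun i j => ((rhat i * rhat j : ℝ) : ℂ)) ∧
      (ZS = ZT → Udisp a k h Z ZM ZL ZS ZT (a • rhat) = 1) := by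
  have key : Udisp a k h Z ZM ZL ZS ZT (a • rhat)
        = 1 + ((ZS - ZT) / ZT * ((Z + ZM) / (ZS + ZM))) •
            ((1 : Matrix (Fin 3) (Fin 3) ℂ)
              - Matrix.of fun i j => ((rhat i * rhat j : ℝ) : ℂ)) := by
    obtain ⟨hk0, hL⟩ := imp_ratio a ρ (lam + 2 * mu) ω k ha hρ hlam hω hk ZM ZL hZM
      (by rw [hZL]; push_cast; ring)
    obtain ⟨hh0, hT⟩ := imp_ratio a ρ mu ω h ha hρ hmu hω hh ZM ZT hZM hZT
    have hn : ‖a • rhat‖ = a := by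
      rw [norm_smul, hrhat, mul_one, Real.norm_of_nonneg ha.le]
    have haC : (a : ℂ) ≠ 0 := by exact_mod_cast ha.ne'
    have ho : outerUnit (a • rhat) = Matrix.of fun i j => ((rhat i * rhat j : ℝ) : ℂ) := by
      ext i j
      simp only [outerUnit, hn, Matrix.of_apply, PiLp.smul_apply, smul_eq_mul]
      rw [mul_div_cancel_left₀ _ ha.ne', mul_div_cancel_left₀ _ ha.ne']
    have hp : 1 / ((k : ℂ) * a) ^ 2 - I / ((k : ℂ) * a) = -ZL / (3 * ZM) := by
      rw [hL]; field_simp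
    have hq : 1 / ((h : ℂ) * a) ^ 2 - I / ((h : ℂ) * a) = -ZT / (3 * ZM) := by
      rw [hT]; field_simp
    have hp2 : 1 + 3 * I / ((k : ℂ) * a) - 3 / ((k : ℂ) * a) ^ 2 = (ZL + ZM) / ZM := by
      have : (ZL + ZM) / ZM = 1 - 3 * (-ZL / (3 * ZM)) := by field_simp; ring
      rw [this, ← hp]; ring
    have hq2 : 1 + 3 * I / ((h : ℂ) * a) - 3 / ((h : ℂ) * a) ^ 2 = (ZT + ZM) / ZM := by
      have : (ZT + ZM) / ZM = 1 - 3 * (-ZT / (3 * ZM)) := by field_simp; ring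
      rw [this, ← hq]; ring
    have hq1 : 1 + I / ((h : ℂ) * a) - 1 / ((h : ℂ) * a) ^ 2 = (ZT + 3 * ZM) / (3 * ZM) := by
      have : (ZT + 3 * ZM) / (3 * ZM) = 1 - (-ZT / (3 * ZM)) := by field_simp; ring
      rw [this, ← hq]; ring
    have hZZ : Z + ZM ≠ 0 := by
      intro h0
      rw [h0, div_zero] at hZ
      exact hsum hZ.symm
    unfold Udisp
    rw [ho, hn, hp, hp2, hq1, hq2]
    generalize (Matrix.of fun i j => ((rhat i * rhat j : ℝ) : ℂ)) = P
    rw [sub_self, mul_zero, mul_zero, Complex.exp_zero, div_self haC, mul_one, mul_one]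
    generalize Z + ZM = W at *
    have hI : W * (1 / (ZL + ZM) * (-ZL / (3 * ZM)) +
        ZS / ZT / (ZS + ZM) * ((ZT + 3 * ZM) / (3 * ZM)))
        = 1 + (ZS - ZT) / ZT * (W / (ZS + ZM)) := by
      have h1 : (1 : ℂ) = W * ((1 / (ZL + ZM) + 2 / (ZS + ZM)) / 3) := by
        rw [← hZ]; field_simp
      have h2 : 1 / (ZL + ZM) * (-ZL / (3 * ZM)) +
        ZS / ZT / (ZS + ZM) * ((ZT + 3 * ZM) / (3 * ZM)) =
        (1 / (ZL + ZM) + 2 / (ZS + ZM)) / 3 + (ZS - ZT) / ZT * (1 / (ZS + ZM)) := by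
        clear h1 hZ hsum hp hq hp2 hq2 hq1 hL hT hZL hZT hZM
        field_simp
        ring
      rw [h2, mul_add, ← h1]; ring
    have hP : W * (1 / (ZL + ZM) * ((ZL + ZM) / ZM) -
        ZS / ZT / (ZS + ZM) * ((ZT + ZM) / ZM))
        = -((ZS - ZT) / ZT * (W / (ZS + ZM))) := by
      clear hZ hsum hp hq hp2 hq2 hq1 hL hT hZL hZT hZM
      field_simp
      ring
    have e : ∀ x y z u v w t : ℂ, x • (y • (z • (1 : Matrix (Fin 3) (Fin 3) ℂ) + u • P)
        + v • (w • (1 : Matrix (Fin 3) (Fin 3) ℂ) - t • P))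
        = (x * (y * z + v * w)) • (1 : Matrix (Fin 3) (Fin 3) ℂ)
          + (x * (y * u - v * t)) • P := by
      intros; module
    rw [e, hI, hP]
    module
  refine ⟨key, fun hST => ?_⟩
  rw [key, hST]
  simp
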